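/- arXiv:2301.04095 — 3 statements merged into one kernel-verified Lean document; each statement's English description precedes it below -/
import Mathlib

section
/- Let 1 ≤ p ≤ 2. Let (Z₁, Z₂) be a pair of random variables with Z₁ taking values in a standard Borel space and Z₂ real-valued with E[|Z₂|^p] < ∞. Let Z₂(1), …, Z₂(n) be conditionally i.i.d. given Z₁, each with the conditional distribution of Z₂ given Z₁. Then there is a constant B′_p depending only on p such that E[|(1/n) Σ_{i=1}^n Z₂(i) − E[Z₂ | Z₁]|^p] ≤ B′_p · E[|Z₂|^p] / n^{p−1}. -/
open MeasureTheory ProbabilityTheory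
open scoped ENNReal

/-- The odd extension `sign x * |x| ^ r` of the power function. -/
noncomputable def signedRpow (r x : ℝ) : ℝ := Real.sign x * |x| ^ r

lemma measurable_signedRpow (r : ℝ) : Measurable (signedRpow r) := by
  have h : Measurable Real.sign := by
    unfold Real.sign
    exact Measurable.ite measurableSet_Iio measurable_const
      (Measurable.ite measurableSet_Ioi measurable_const measurable_const)
  unfold signedRpow
  fun_prop

lemma signedRpow_of_pos {r x : ℝ} (hx : 0 < x) : signedRpow r x = x ^ r := by
  simp [signedRpow, Real.sign_of_pos hx, abs_of_pos hx]

lemma signedRpow_neg (r x : ℝ) : signedRpow r (-x) = -signedRpow r x := by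
  simp [signedRpow, Real.sign_neg]

lemma abs_signedRpow_le (r x : ℝ) : |signedRpow r x| ≤ |x| ^ r := by
  have h : |Real.sign x| ≤ 1 := by
    rcases Real.sign_apply_eq x with h | h | h <;> simp [h]
  rw [signedRpow, abs_mul, abs_of_nonneg (Real.rpow_nonneg (abs_nonneg x) r)]
  exact mul_le_of_le_one_left (Real.rpow_nonneg (abs_nonneg x) r) h

lemma signedRpow_sub_one_mul_self {p : ℝ} (hp : p ≠ 0) (x : ℝ) :
    signedRpow (p - 1) x * x = |x| ^ p := by
  rcases eq_or_ne x 0 with rfl | hx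
  · simp [Real.zero_rpow hp]
  · have h : |x| ≠ 0 := abs_ne_zero.mpr hx
    have hsign : Real.sign x * x = |x| := by
      rcases hx.lt_or_gt with hx | hx
      · simp [Real.sign_of_neg hx, abs_of_neg hx]
      · simp [Real.sign_of_pos hx, abs_of_pos hx]
    rw [signedRpow, mul_right_comm, hsign, mul_comm, Real.rpow_sub_one h, div_mul_cancel₀ _ h]

lemma mul_abs_rpow_sub_one_mul_abs_le {p : ℝ} (hp : 1 ≤ p) (x y : ℝ) :
    p * (|x| ^ (p - 1) * |y|) ≤ (p - 1) * |x| ^ p + |y| ^ p := by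
  have hp0 : 0 < p := by linarith
  have h := Real.geom_mean_le_arith_mean2_weighted (w₁ := (p - 1) / p) (w₂ := 1 / p)
    (p₁ := |x| ^ p) (p₂ := |y| ^ p) (div_nonneg (by linarith) hp0.le) (by positivity)
    (by positivity) (by positivity) (by field_simp; ring)
  rw [← Real.rpow_mul (abs_nonneg x), ← Real.rpow_mul (abs_nonneg y),
    mul_div_cancel₀ _ hp0.ne', mul_one_div_cancel hp0.ne', Real.rpow_one] at h
  calc _ ≤ p * ((p - 1) / p * |x| ^ p + 1 / p * |y| ^ p) := by gcongr
    _ = _ := by field_simp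

lemma abs_rpow_add_le_tangent {p : ℝ} (hp : 1 ≤ p) (x y : ℝ) :
    |x| ^ p + p * signedRpow (p - 1) x * (y - x) ≤ |y| ^ p := by
  have h1 := signedRpow_sub_one_mul_self (by linarith : p ≠ 0) x
  have h2 : signedRpow (p - 1) x * y ≤ |x| ^ (p - 1) * |y| := by
    refine (le_abs_self _).trans ?_
    rw [abs_mul]
    gcongr
    exact abs_signedRpow_le _ _
  have h3 := mul_abs_rpow_sub_one_mul_abs_le hp x y
  have h4 := mul_le_mul_of_nonneg_left h2 (by linarith : 0 ≤ p)
  linear_combination h3 + h4 - p * h1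

lemma signedRpow_sub_le_of_pos {r : ℝ} (hr0 : 0 ≤ r) (hr1 : r ≤ 1) {x y : ℝ} (hx : 0 < x)
    (hy : 0 < y) : signedRpow r x - signedRpow r y ≤ 2 * |x - y| ^ r := by
  have h0 : 0 ≤ |x - y| ^ r := by positivity
  rw [signedRpow_of_pos hx, signedRpow_of_pos hy]
  have h := Real.rpow_add_le_add_rpow hy.le (abs_nonneg (x - y)) hr0 hr1
  have h' : x ^ r ≤ (y + |x - y|) ^ r :=
    Real.rpow_le_rpow hx.le (by linarith [le_abs_self (x - y)]) hr0
  linarith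

lemma signedRpow_sub_le {r : ℝ} (hr0 : 0 ≤ r) (hr1 : r ≤ 1) (x y : ℝ) :
    signedRpow r x - signedRpow r y ≤ 2 * |x - y| ^ r := by
  have hsplit (h : x * y ≤ 0) : signedRpow r x - signedRpow r y ≤ 2 * |x - y| ^ r := by
    have hx := (le_abs_self _).trans (abs_signedRpow_le r x)
    have hy := (neg_le_abs _).trans (abs_signedRpow_le r y)
    have hx' : |x| ^ r ≤ |x - y| ^ r :=
      Real.rpow_le_rpow (abs_nonneg _) (sq_le_sq.mp (by nlinarith [sq_nonneg y])) hr0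
    have hy' : |y| ^ r ≤ |x - y| ^ r :=
      Real.rpow_le_rpow (abs_nonneg _) (sq_le_sq.mp (by nlinarith [sq_nonneg x])) hr0
    linarith
  rcases le_or_gt (x * y) 0 with h | h
  · exact hsplit h
  · rcases mul_pos_iff.mp h with ⟨hx, hy⟩ | ⟨hx, hy⟩
    · exact signedRpow_sub_le_of_pos hr0 hr1 hx hy
    · have := signedRpow_sub_le_of_pos hr0 hr1 (neg_pos.mpr hy) (neg_pos.mpr hx)
      rw [signedRpow_neg, signedRpow_neg, show -y - -x = x - y by ring] at this
      linarith

lemma abs_signedRpow_sub_le {r : ℝ} (hr0 : 0 ≤ r) (hr1 : r ≤ 1) (x y : ℝ) :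
    |signedRpow r x - signedRpow r y| ≤ 2 * |x - y| ^ r := by
  refine abs_le'.mpr ⟨signedRpow_sub_le hr0 hr1 x y, ?_⟩
  rw [neg_sub, abs_sub_comm]
  exact signedRpow_sub_le hr0 hr1 y x

lemma abs_add_rpow_le {p : ℝ} (hp1 : 1 ≤ p) (hp2 : p ≤ 2) (a b : ℝ) :
    |a + b| ^ p ≤ |a| ^ p + p * (signedRpow (p - 1) a * b) + 4 * |b| ^ p := by
  have h1 := abs_rpow_add_le_tangent hp1 (a + b) a
  have h2 := abs_signedRpow_sub_le (by linarith : 0 ≤ p - 1) (by linarith) (a + b) a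
  rw [add_sub_cancel_left] at h2
  have h3 : (signedRpow (p - 1) (a + b) - signedRpow (p - 1) a) * b ≤ 2 * |b| ^ p := by
    have hb : |b| ^ (p - 1) * |b| = |b| ^ p := by
      rw [← Real.rpow_add_one' (abs_nonneg b) (by linarith), sub_add_cancel]
    refine (le_abs_self _).trans ?_
    rw [abs_mul, ← hb, ← mul_assoc]
    gcongr
  have h4 := mul_le_mul_of_nonneg_left h3 (by linarith : 0 ≤ p)
  have h5 : 0 ≤ |b| ^ p := by positivity
  nlinarith

lemma abs_rpow_le_one_add {p q : ℝ} (hp : 0 ≤ p) (hpq : p ≤ q) (x : ℝ) :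
    |x| ^ p ≤ 1 + |x| ^ q := by
  have h0 : 0 ≤ |x| ^ q := by positivity
  rcases le_total |x| 1 with h | h
  · linarith [Real.rpow_le_one (abs_nonneg x) h hp]
  · linarith [Real.rpow_le_rpow_of_exponent_le h hpq]

section Moments

variable {Ω : Type*} [MeasurableSpace Ω] {P : Measure Ω} [IsProbabilityMeasure P] {p : ℝ}
  {X Y : Ω → ℝ}

lemma integrable_of_integrable_abs_rpow (hp : 1 ≤ p) (hX : Measurable X)
    (hXp : Integrable (fun ω => |X ω| ^ p) P) : Integrable X P := by
  refine ((integrable_const (1 : ℝ)).add hXp).mono' hX.aestronglyMeasurable (.of_forall fun ω => ?_)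
  simpa using abs_rpow_le_one_add zero_le_one hp (X ω)

lemma integrable_signedRpow (hp : 1 ≤ p) (hX : Measurable X)
    (hXp : Integrable (fun ω => |X ω| ^ p) P) :
    Integrable (fun ω => signedRpow (p - 1) (X ω)) P := by
  refine ((integrable_const (1 : ℝ)).add hXp).mono'
    ((measurable_signedRpow _).comp hX).aestronglyMeasurable (.of_forall fun ω => ?_)
  exact (abs_signedRpow_le _ _).trans
    (abs_rpow_le_one_add (by linarith) (by linarith) (X ω))

lemma integral_abs_add_rpow_le (hp1 : 1 ≤ p) (hp2 : p ≤ 2) (hX : Measurable X)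
    (hY : Measurable Y) (hXY : IndepFun X Y P) (hXp : Integrable (fun ω => |X ω| ^ p) P)
    (hYp : Integrable (fun ω => |Y ω| ^ p) P) (hY0 : ∫ ω, Y ω ∂P = 0) :
    Integrable (fun ω => |X ω + Y ω| ^ p) P ∧
      ∫ ω, |X ω + Y ω| ^ p ∂P ≤ ∫ ω, |X ω| ^ p ∂P + 4 * ∫ ω, |Y ω| ^ p ∂P := by
  have hg := integrable_signedRpow hp1 hX hXp
  have hind : IndepFun (fun ω => signedRpow (p - 1) (X ω)) Y P :=
    hXY.comp (measurable_signedRpow _) measurable_id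
  have hgY : Integrable (fun ω => signedRpow (p - 1) (X ω) * Y ω) P :=
    hind.integrable_mul hg (integrable_of_integrable_abs_rpow hp1 hY hYp)
  have hgY0 : ∫ ω, signedRpow (p - 1) (X ω) * Y ω ∂P = 0 := by
    rw [hind.integral_fun_mul_eq_mul_integral hg.aestronglyMeasurable hY.aestronglyMeasurable,
      hY0, mul_zero]
  have h1 : Integrable (fun ω => |X ω| ^ p + p * (signedRpow (p - 1) (X ω) * Y ω)) P :=
    hXp.add (hgY.const_mul p)
  have hbound : Integrable
      (fun ω => |X ω| ^ p + p * (signedRpow (p - 1) (X ω) * Y ω) + 4 * |Y ω| ^ p) P :=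
    h1.add (hYp.const_mul 4)
  have hint : Integrable (fun ω => |X ω + Y ω| ^ p) P := by
    refine hbound.mono' (Measurable.aestronglyMeasurable (by fun_prop)) (.of_forall fun ω => ?_)
    rw [Real.norm_of_nonneg (by positivity)]
    exact abs_add_rpow_le hp1 hp2 _ _
  refine ⟨hint, (integral_mono hint hbound fun ω => abs_add_rpow_le hp1 hp2 _ _).trans_eq ?_⟩
  rw [integral_add h1 (hYp.const_mul 4), integral_add hXp (hgY.const_mul p),
    integral_const_mul, integral_const_mul, hgY0]
  ring

/-- The von Bahr–Esseen inequality, with constant `4`. -/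
lemma integral_abs_sum_rpow_le {ι : Type*} (hp1 : 1 ≤ p) (hp2 : p ≤ 2) {X : ι → Ω → ℝ}
    (hX : ∀ i, Measurable (X i)) (hind : iIndepFun X P)
    (hXp : ∀ i, Integrable (fun ω => |X i ω| ^ p) P) (hX0 : ∀ i, ∫ ω, X i ω ∂P = 0)
    (s : Finset ι) :
    Integrable (fun ω => |∑ i ∈ s, X i ω| ^ p) P ∧
      ∫ ω, |∑ i ∈ s, X i ω| ^ p ∂P ≤ 4 * ∑ i ∈ s, ∫ ω, |X i ω| ^ p ∂P := by
  classical
  induction s using Finset.induction_on with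
  | empty => simp [Real.zero_rpow (by linarith : p ≠ 0)]
  | insert i s hi ih =>
    have hI : IndepFun (fun ω => ∑ j ∈ s, X j ω) (X i) P := by
      simpa only [Finset.sum_fn] using hind.indepFun_finsetSum_of_notMem hX hi
    have h := integral_abs_add_rpow_le hp1 hp2 (by fun_prop) (hX i) hI ih.1 (hXp i) (hX0 i)
    simp only [Finset.sum_insert hi, add_comm (X i _)]
    exact ⟨h.1, by linarith [h.2, ih.2]⟩

lemma integral_abs_sub_integral_rpow_le (hp1 : 1 ≤ p) (hp2 : p ≤ 2) (hX : Measurable X)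
    (hXp : Integrable (fun ω => |X ω| ^ p) P) :
    Integrable (fun ω => |X ω - ∫ ω', X ω' ∂P| ^ p) P ∧
      ∫ ω, |X ω - ∫ ω', X ω' ∂P| ^ p ∂P ≤ 4 * ∫ ω, |X ω| ^ p ∂P := by
  set m := ∫ ω', X ω' ∂P with hm
  have hXi := integrable_of_integrable_abs_rpow hp1 hX hXp
  have h1 : Integrable (fun ω => |m| ^ p + p * (signedRpow (p - 1) (-m) * X ω)) P :=
    (integrable_const _).add ((hXi.const_mul _).const_mul p)
  have hle (ω : Ω) : |X ω - m| ^ p ≤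
      |m| ^ p + p * (signedRpow (p - 1) (-m) * X ω) + 4 * |X ω| ^ p := by
    have h := abs_add_rpow_le hp1 hp2 (-m) (X ω)
    rwa [abs_neg, neg_add_eq_sub] at h
  have hbound := h1.add (hXp.const_mul 4)
  have hint : Integrable (fun ω => |X ω - m| ^ p) P := by
    refine hbound.mono' (Measurable.aestronglyMeasurable (by fun_prop)) (.of_forall fun ω => ?_)
    rw [Real.norm_of_nonneg (by positivity)]
    exact hle ω
  refine ⟨hint, (integral_mono hint hbound hle).trans ?_⟩
  simp only [Pi.add_apply]
  rw [integral_add h1 (hXp.const_mul 4),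
    integral_add (integrable_const _) ((hXi.const_mul _).const_mul p), integral_const_mul,
    integral_const_mul, integral_const_mul, ← hm, signedRpow_neg, neg_mul,
    signedRpow_sub_one_mul_self (by linarith)]
  have h0 : 0 ≤ |m| ^ p := by positivity
  simp only [integral_const, probReal_univ, one_smul]
  nlinarith

end Moments

lemma lintegral_pi_abs_mean_sub_integral_rpow_le {p : ℝ} (hp1 : 1 ≤ p) (hp2 : p ≤ 2)
    (ν : Measure ℝ) [IsProbabilityMeasure ν] {n : ℕ} (hn : 0 < n)
    (hν : Integrable (fun x => |x| ^ p) ν) :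
    ∫⁻ x, ENNReal.ofReal (|(∑ i, x i) / n - ∫ t, t ∂ν| ^ p) ∂(Measure.pi fun _ : Fin n => ν) ≤
      ENNReal.ofReal (16 / (n : ℝ) ^ (p - 1)) * ∫⁻ x, ENNReal.ofReal (|x| ^ p) ∂ν := by
  have hn' : (0 : ℝ) < n := by exact_mod_cast hn
  set m := ∫ t, t ∂ν with hm
  obtain ⟨hc, hcle⟩ := integral_abs_sub_integral_rpow_le hp1 hp2 measurable_id hν
  simp only [id_eq, ← hm] at hc hcle
  have hid := integrable_of_integrable_abs_rpow hp1 measurable_id hν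
  let Q := Measure.pi fun _ : Fin n => ν
  have hmp (i : Fin n) : MeasurePreserving (Function.eval i) Q ν :=
    measurePreserving_eval (fun _ : Fin n => ν) i
  have hev {f : ℝ → ℝ} (hf : Measurable f) (i : Fin n) : ∫ x, f (x i) ∂Q = ∫ t, f t ∂ν := by
    rw [← (hmp i).map_eq, integral_map (hmp i).measurable.aemeasurable hf.aestronglyMeasurable]
  obtain ⟨hS, hSle⟩ := integral_abs_sum_rpow_le (P := Q) hp1 hp2
    (X := fun (i : Fin n) x => x i - m) (fun i => by fun_prop)
    (iIndepFun_pi (X := fun _ t => t - m) fun i => by fun_prop)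
    (fun i => (hmp i).integrable_comp_of_integrable hc)
    (fun i => by
      rw [hev (f := fun t => t - m) (by fun_prop), integral_sub (f := fun t : ℝ => t) hid (integrable_const _)]
      simp [hm])
    Finset.univ
  have hscale (x : Fin n → ℝ) :
      |(∑ i, x i) / n - m| ^ p = |∑ i, (x i - m)| ^ p * ((n : ℝ) ^ p)⁻¹ := by
    rw [← div_eq_mul_inv, ← Real.div_rpow (abs_nonneg _) hn'.le, ← abs_of_pos hn', ← abs_div,
      abs_of_pos hn']
    congr 2
    simp [sub_div, hn'.ne']
  have hnp : (n : ℝ) ^ p = n ^ (p - 1) * n := by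
    rw [← Real.rpow_add_one hn'.ne', sub_add_cancel]
  simp only [hscale]
  rw [← ofReal_integral_eq_lintegral_ofReal (hS.mul_const _) (.of_forall fun x => by positivity),
    ← ofReal_integral_eq_lintegral_ofReal hν (.of_forall fun x => by positivity),
    ← ENNReal.ofReal_mul (by positivity)]
  refine ENNReal.ofReal_le_ofReal ?_
  rw [integral_mul_const]
  have hsum : ∑ i : Fin n, ∫ x, |x i - m| ^ p ∂Q = n * ∫ t, |t - m| ^ p ∂ν := by
    simp [hev (f := fun t => |t - m| ^ p) (by fun_prop)]
  calc _ ≤ 4 * (n * (4 * ∫ t, |t| ^ p ∂ν)) * ((n : ℝ) ^ p)⁻¹ := by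
        rw [hsum] at hSle
        have : (n : ℝ) * ∫ t, |t - m| ^ p ∂ν ≤ n * (4 * ∫ t, |t| ^ p ∂ν) := by gcongr
        gcongr
        exact hSle.trans (by linarith)
    _ = _ := by
      rw [hnp]
      field_simp
      ring

/-- for `1 ≤ p ≤ 2` there is a constant `B′_p` depending only on `p` such that,
whenever `(Z₁, Z₂)` is a pair of random variables (`Z₁` in a standard Borel space, `Z₂` real
with `E[|Z₂|^p] < ∞`, conditional distribution kernel `κ` of `Z₂` given `Z₁`) and
`Z₂(1), …, Z₂(n)` are conditionally i.i.d. given `Z₁` with that conditional distribution, then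
`E[|(1/n)∑ᵢ Z₂(i) − E[Z₂ | Z₁]|^p] ≤ B′_p · E[|Z₂|^p] / n^{p−1}`. -/
theorem stmt_6 (p : ℝ) (hp1 : 1 ≤ p) (hp2 : p ≤ 2) :
    ∃ B : ℝ, ∀ (Ω α : Type*) [MeasurableSpace Ω] [MeasurableSpace α] [StandardBorelSpace α]
      (μ : Measure Ω) [IsProbabilityMeasure μ]
      (Z1 : Ω → α) (Z2 : Ω → ℝ) (n : ℕ) (Z2s : Fin n → Ω → ℝ)
      (κ : Kernel α ℝ) [IsMarkovKernel κ] (κn : Kernel α (Fin n → ℝ)) (γ : Ω → ℝ),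
      Measurable Z1 → Measurable Z2 → (∀ i, Measurable (Z2s i)) → 0 < n →
      -- `κ` is a version of the conditional distribution of `Z₂` given `Z₁`:
      μ.map (fun ω => (Z1 ω, Z2 ω)) = (μ.map Z1) ⊗ₘ κ →
      -- conditionally on `Z₁`, the `Z₂(i)` are i.i.d. with law `κ (Z₁)`:
      (∀ y : α, κn y = Measure.pi fun _ : Fin n => κ y) →
      μ.map (fun ω => (Z1 ω, fun i : Fin n => Z2s i ω)) = (μ.map Z1) ⊗ₘ κn →
      -- `γ` is the corresponding version of `E[Z₂ | Z₁]`: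
      (∀ ω, γ ω = ∫ x, x ∂(κ (Z1 ω))) →
      ∫⁻ ω, ENNReal.ofReal (|Z2 ω| ^ p) ∂μ < ⊤ →
      ∫⁻ ω, ENNReal.ofReal (|(∑ i, Z2s i ω) / n - γ ω| ^ p) ∂μ ≤
        ENNReal.ofReal B * (∫⁻ ω, ENNReal.ofReal (|Z2 ω| ^ p) ∂μ) /
          ENNReal.ofReal ((n : ℝ) ^ (p - 1)) := by
  refine ⟨16, ?_⟩
  intro Ω α _ _ _ μ _ Z1 Z2 n Z2s κ _ κn γ hZ1 hZ2 hZ2s hn hκ hpi hκn hγ hfin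
  have : IsProbabilityMeasure (μ.map Z1) := Measure.isProbabilityMeasure_map hZ1.aemeasurable
  have : IsMarkovKernel κn := ⟨fun y => by rw [hpi y]; infer_instance⟩
  have hγm : Measurable fun y => ∫ x, x ∂κ y :=
    (stronglyMeasurable_id.integral_kernel (κ := κ)).measurable
  have hmom : ∫⁻ ω, ENNReal.ofReal (|Z2 ω| ^ p) ∂μ =
      ∫⁻ y, ∫⁻ x, ENNReal.ofReal (|x| ^ p) ∂κ y ∂(μ.map Z1) := by
    rw [← Measure.lintegral_compProd (f := fun z : α × ℝ => ENNReal.ofReal (|z.2| ^ p))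
      (by fun_prop), ← hκ, lintegral_map (by fun_prop) (by fun_prop)]
  have hdev : ∫⁻ ω, ENNReal.ofReal (|(∑ i, Z2s i ω) / n - γ ω| ^ p) ∂μ =
      ∫⁻ y, ∫⁻ x, ENNReal.ofReal (|(∑ i, x i) / n - ∫ t, t ∂κ y| ^ p) ∂κn y ∂(μ.map Z1) := by
    have hF : Measurable fun z : α × (Fin n → ℝ) =>
        ENNReal.ofReal (|(∑ i, z.2 i) / n - ∫ t, t ∂κ z.1| ^ p) := by
      have : Measurable fun z : α × (Fin n → ℝ) => ∫ t, t ∂κ z.1 := hγm.comp measurable_fst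
      fun_prop
    rw [← Measure.lintegral_compProd hF, ← hκn, lintegral_map hF (by fun_prop)]
    simp only [hγ]
  have hm : Measurable fun y => ∫⁻ x, ENNReal.ofReal (|x| ^ p) ∂κ y :=
    Measurable.lintegral_kernel (by fun_prop)
  rw [hmom] at hfin ⊢
  rw [hdev]
  have hae := ae_lt_top hm hfin.ne
  have hn' : (0 : ℝ) < (n : ℝ) ^ (p - 1) := by positivity
  calc _ ≤ ∫⁻ y, ENNReal.ofReal (16 / (n : ℝ) ^ (p - 1)) *
        ∫⁻ x, ENNReal.ofReal (|x| ^ p) ∂κ y ∂(μ.map Z1) := by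
        refine lintegral_mono_ae (hae.mono fun y hy => ?_)
        rw [hpi y]
        refine lintegral_pi_abs_mean_sub_integral_rpow_le hp1 hp2 (κ y) hn ?_
        refine ⟨Measurable.aestronglyMeasurable (by fun_prop), ?_⟩
        rw [hasFiniteIntegral_iff_ofReal (.of_forall fun x => by positivity)]
        exact hy
    _ = _ := by
      rw [lintegral_const_mul _ hm, ENNReal.ofReal_div_of_pos hn', div_eq_mul_inv,
        div_eq_mul_inv]
      ring
end

section
/- Let p ≥ 2 and let g : ℝ^J × ℝ → ℝ satisfy the LBS condition with constant K. Let (Y, X) be a pair of random variables with Y taking values in ℝ^J and X real-valued with E[|X|^{2p}] < ∞, and set γ(Y) := E[X | Y]. For each n ≥ 1 let X(1), …, X(2ⁿ) be conditionally i.i.d. given Y, each with the conditional distribution of X given Y, and set Δ_n := Δ_n(g(Y, ·); X(1), …, X(2ⁿ)). Then there exists a constant C depending only on p and K such that for every n ≥ 1, E[|Δ_n|^p] ≤ C · E[|X|^{2p}] · 2^{−pn}. -/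
open MeasureTheory ProbabilityTheory
open scoped ENNReal

/-- The antithetic multilevel difference `Δ_n(h; a₁, …, a_{2ⁿ})` (0-indexed sequence). -/
noncomputable def deltaN (h : ℝ → ℝ) (n : ℕ) (a : ℕ → ℝ) : ℝ :=
  if n = 0 then h (a 0)
  else h ((∑ i ∈ Finset.range (2 ^ n), a i) / 2 ^ n) -
    (1 / 2) * (h ((∑ k ∈ Finset.range (2 ^ (n - 1)), a (2 * k)) / 2 ^ (n - 1)) +
      h ((∑ k ∈ Finset.range (2 ^ (n - 1)), a (2 * k + 1)) / 2 ^ (n - 1)))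

/-- `g : ℝ^J × ℝ → ℝ` satisfies the LBS condition with constant `K`: `g (y, ·)` is twice
differentiable for every `y`, with `|∂²_z g (y, z)| ≤ K` everywhere. -/
def LBS {J : Type*} (g : J → ℝ → ℝ) (K : ℝ) : Prop :=
  ∀ y, Differentiable ℝ (g y) ∧ Differentiable ℝ (deriv (g y)) ∧
    ∀ z, |deriv (deriv (g y)) z| ≤ K

lemma abs_midpoint_sub_le {h : ℝ → ℝ} {K : ℝ} (h1 : Differentiable ℝ h)
    (h2 : Differentiable ℝ (deriv h)) (hK : ∀ z, |deriv (deriv h) z| ≤ K) (a b : ℝ) :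
    |h ((a + b) / 2) - 1 / 2 * (h a + h b)| ≤ K / 8 * (a - b) ^ 2 := by
  have upper : ∀ {f : ℝ → ℝ}, Differentiable ℝ f → Differentiable ℝ (deriv f) →
      (∀ z, |deriv (deriv f) z| ≤ K) →
      f ((a + b) / 2) - 1 / 2 * (f a + f b) ≤ K / 8 * (a - b) ^ 2 := by
    intro f hf hf' hb
    have hd : deriv (fun x => f x + K / 2 * x ^ 2) = fun x => deriv f x + K * x := by
      funext x
      have := (hf x).hasDerivAt.add (((hasDerivAt_id x).pow 2).const_mul (K / 2))
      refine (this.congr_deriv ?_).deriv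
      simp
      ring
    have hd2 : ∀ x, HasDerivAt (fun x => deriv f x + K * x) (deriv (deriv f) x + K) x := by
      intro x
      exact ((hf' x).hasDerivAt.add ((hasDerivAt_id x).const_mul K)).congr_deriv (by simp)
    have hconv : ConvexOn ℝ Set.univ (fun x => f x + K / 2 * x ^ 2) := by
      refine convexOn_univ_of_deriv2_nonneg (by fun_prop) ?_ fun x => ?_
      · rw [hd]; fun_prop
      · rw [Function.iterate_succ, Function.iterate_one, Function.comp_apply, hd, (hd2 x).deriv]
        linarith [neg_le_of_abs_le (hb x)]
    have := hconv.2 (Set.mem_univ a) (Set.mem_univ b) 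
      (by norm_num : (0 : ℝ) ≤ 1 / 2) (by norm_num : (0 : ℝ) ≤ 1 / 2) (by norm_num)
    simp only [smul_eq_mul] at this
    rw [show 1 / 2 * a + 1 / 2 * b = (a + b) / 2 by ring] at this
    nlinarith
  have hneg : deriv (-h) = -deriv h := by
    funext x; exact deriv.neg
  rw [abs_le]
  constructor
  · have := upper (f := -h) h1.neg (by rw [hneg]; exact h2.neg)
      (fun z => by rw [hneg, deriv.neg, abs_neg]; exact hK z)
    simp only [Pi.neg_apply] at this
    linarith
  · exact upper h1 h2 hK

lemma sum_signs_exp_le {ι : Type*} [Fintype ι] [DecidableEq ι] (z : ι → ℝ) :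
    ∑ ε : ι → Bool, Real.exp (∑ k, bif ε k then -z k else z k) ≤
      2 ^ Fintype.card ι * Real.exp ((∑ k, z k ^ 2) / 2) := by
  calc ∑ ε : ι → Bool, Real.exp (∑ k, bif ε k then -z k else z k)
      = ∏ k, ∑ b : Bool, Real.exp (bif b then -z k else z k) := by
        rw [Finset.prod_univ_sum, Fintype.piFinset_univ]
        simp_rw [Real.exp_sum]
    _ ≤ ∏ k, 2 * Real.exp (z k ^ 2 / 2) := by
        refine Finset.prod_le_prod (fun k _ => by positivity) fun k _ => ?_
        have := Real.cosh_le_exp_half_sq (z k)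
        rw [Real.cosh_eq] at this
        simp only [Fintype.sum_bool, cond_true, cond_false]
        linarith
    _ = _ := by
        rw [Finset.prod_mul_distrib, Finset.prod_const, ← Real.exp_sum, Finset.sum_div]
        rfl

lemma sum_signs_exp_abs_le {ι : Type*} [Fintype ι] [DecidableEq ι] (z : ι → ℝ) :
    ∑ ε : ι → Bool, Real.exp |∑ k, bif ε k then -z k else z k| ≤
      2 * 2 ^ Fintype.card ι * Real.exp ((∑ k, z k ^ 2) / 2) := by
  have h1 := sum_signs_exp_le z
  have h2 := sum_signs_exp_le (fun k => -z k)
  have h3 : ∑ ε : ι → Bool, Real.exp |∑ k, bif ε k then -z k else z k| ≤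
      ∑ ε : ι → Bool, (Real.exp (∑ k, bif ε k then -z k else z k) +
        Real.exp (∑ k, bif ε k then - -z k else -z k)) := by
    refine Finset.sum_le_sum fun ε _ => ?_
    have : ∑ k, (bif ε k then - -z k else -z k) = -∑ k, bif ε k then -z k else z k := by
      rw [← Finset.sum_neg_distrib]
      exact Finset.sum_congr rfl fun k _ => by cases ε k <;> simp
    rw [this]
    rcases abs_choice (∑ k, bif ε k then -z k else z k) with h | h <;> rw [h]
    · linarith [Real.exp_pos (-∑ k, bif ε k then -z k else z k)]
    · linarith [Real.exp_pos (∑ k, bif ε k then -z k else z k)]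
  rw [Finset.sum_add_distrib] at h3
  simp only [neg_sq] at h2
  linarith

/-- Khintchine's inequality for the exponent `q`. -/
lemma sum_signs_rpow_le {ι : Type*} [Fintype ι] [DecidableEq ι] {q : ℝ} (hq : 0 < q)
    (z : ι → ℝ) :
    ∑ ε : ι → Bool, |∑ k, bif ε k then -z k else z k| ^ q ≤
      2 ^ Fintype.card ι * (2 * q ^ q * Real.exp (1 / 2)) * √(∑ k, z k ^ 2) ^ q := by
  have hnn : 0 ≤ ∑ k, z k ^ 2 := Finset.sum_nonneg fun k _ => sq_nonneg _
  rcases hnn.eq_or_lt with h0 | hpos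
  · have hz : ∀ k, z k = 0 := fun k => by
      simpa using (Finset.sum_eq_zero_iff_of_nonneg fun k _ => sq_nonneg (z k)).1 h0.symm k
    simp [hz, Real.zero_rpow hq.ne']
  set r := √(∑ k, z k ^ 2) with hr
  have hr0 : 0 < r := Real.sqrt_pos.2 hpos
  have hunit : ∑ k, (z k / r) ^ 2 = 1 := by
    simp_rw [div_pow]
    rw [← Finset.sum_div, Real.sq_sqrt hnn, div_self hpos.ne']
  have hscale (ε : ι → Bool) : |∑ k, bif ε k then -z k else z k| ^ q ≤
      r ^ q * (q ^ q * Real.exp |∑ k, bif ε k then -(z k / r) else z k / r|) := by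
    have : ∑ k, (bif ε k then -z k else z k) =
        r * ∑ k, bif ε k then -(z k / r) else z k / r := by
      rw [Finset.mul_sum]
      refine Finset.sum_congr rfl fun k _ => ?_
      cases ε k <;> simp <;> field_simp
    rw [this, abs_mul, abs_of_pos hr0, Real.mul_rpow hr0.le (abs_nonneg _)]
    gcongr
    simpa using ProbabilityTheory.rpow_abs_le_mul_exp_abs
      (∑ k, bif ε k then -(z k / r) else z k / r) hq.le one_ne_zero
  refine (Finset.sum_le_sum fun ε _ => hscale ε).trans ?_
  rw [← Finset.mul_sum, ← Finset.mul_sum]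
  have := sum_signs_exp_abs_le (fun k => z k / r)
  rw [hunit] at this
  calc _ ≤ r ^ q * (q ^ q * (2 * 2 ^ Fintype.card ι * Real.exp (1 / 2))) := by gcongr
    _ = _ := by ring

lemma sum_signs_rpow_le_sum_rpow {ι : Type*} [Fintype ι] [DecidableEq ι] {p : ℝ} (hp : 1 ≤ p)
    (z : ι → ℝ) :
    ∑ ε : ι → Bool, |∑ k, bif ε k then -z k else z k| ^ (2 * p) ≤
      2 ^ Fintype.card ι * (2 * (2 * p) ^ (2 * p) * Real.exp (1 / 2)) *
        ((Fintype.card ι : ℝ) ^ (p - 1) * ∑ k, |z k| ^ (2 * p)) := by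
  refine (sum_signs_rpow_le (by linarith) z).trans ?_
  gcongr
  have hnn : 0 ≤ ∑ k, z k ^ 2 := Finset.sum_nonneg fun k _ => sq_nonneg _
  rw [Real.rpow_mul (Real.sqrt_nonneg _), Real.rpow_two, Real.sq_sqrt hnn]
  refine (Real.rpow_sum_le_const_mul_sum_rpow_of_nonneg Finset.univ hp
    (f := fun k => z k ^ 2) fun k _ => sq_nonneg _).trans_eq ?_
  simp_rw [Real.rpow_mul (abs_nonneg _), Real.rpow_two, sq_abs]
  rfl

lemma abs_deltaN_succ_le {h : ℝ → ℝ} {K : ℝ} (h1 : Differentiable ℝ h)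
    (h2 : Differentiable ℝ (deriv h)) (hK : ∀ z, |deriv (deriv h) z| ≤ K) (m : ℕ) (a : ℕ → ℝ) :
    |deltaN h (m + 1) a| ≤
      K / 8 * ((∑ k ∈ Finset.range (2 ^ m), (a (2 * k) - a (2 * k + 1))) / 2 ^ m) ^ 2 := by
  have hsplit (N : ℕ) : ∑ i ∈ Finset.range (2 * N), a i =
      ∑ k ∈ Finset.range N, a (2 * k) + ∑ k ∈ Finset.range N, a (2 * k + 1) := by
    induction N with
    | zero => simp
    | succ N ih =>
      rw [Nat.mul_succ, Finset.sum_range_succ, Finset.sum_range_succ, ih,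
        Finset.sum_range_succ, Finset.sum_range_succ]
      ring
  have hmid := abs_midpoint_sub_le h1 h2 hK
    ((∑ k ∈ Finset.range (2 ^ m), a (2 * k)) / 2 ^ m)
    ((∑ k ∈ Finset.range (2 ^ m), a (2 * k + 1)) / 2 ^ m)
  rw [deltaN, if_neg m.succ_ne_zero, Nat.add_sub_cancel, pow_succ' (2 : ℕ), hsplit,
    Finset.sum_sub_distrib, sub_div]
  have hhalf (A B : ℝ) : (A + B) / 2 ^ (m + 1) = (A / 2 ^ m + B / 2 ^ m) / 2 := by
    rw [pow_succ]
    ring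
  rw [hhalf]
  exact hmid

lemma measurePreserving_pi_comp_perm {τ : Type*} [Fintype τ] (ν : Measure ℝ)
    [IsProbabilityMeasure ν] (σ : Equiv.Perm τ) :
    MeasurePreserving (fun (x : τ → ℝ) i => x (σ i))
      (Measure.pi fun _ => ν) (Measure.pi fun _ => ν) := by
  convert! measurePreserving_piCongrLeft (fun _ : τ => ν) σ.symm using 1
  ext x i
  obtain ⟨j, rfl⟩ := σ.symm.surjective i
  simp [MeasurableEquiv.coe_piCongrLeft]

lemma abs_sub_rpow_le {q : ℝ} (hq : 0 ≤ q) (a b : ℝ) :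
    |a - b| ^ q ≤ 2 ^ q * (|a| ^ q + |b| ^ q) := by
  have hmax : |a - b| ≤ 2 * max |a| |b| := by
    linarith [abs_sub a b, le_max_left |a| |b|, le_max_right |a| |b|]
  calc |a - b| ^ q ≤ (2 * max |a| |b|) ^ q := by gcongr
    _ = 2 ^ q * max |a| |b| ^ q := Real.mul_rpow (by norm_num) (by positivity)
    _ ≤ _ := by
      gcongr
      have ha : 0 ≤ |a| ^ q := by positivity
      have hb : 0 ≤ |b| ^ q := by positivity
      rcases max_choice |a| |b| with h | h <;> rw [h] <;> linarith

/-- The constant in the moment bound for a sum of differences of i.i.d. pairs. -/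
noncomputable def pairConst (p : ℝ) : ℝ :=
  2 * (2 * (2 * p) ^ (2 * p) * Real.exp (1 / 2)) * 2 ^ (2 * p)

lemma lintegral_abs_sum_sub_rpow_le {ι τ : Type*} [Fintype ι] [Nonempty ι] [Fintype τ]
    (e : ι × Bool ≃ τ) {p : ℝ} (hp : 1 ≤ p) (ν : Measure ℝ) [IsProbabilityMeasure ν] :
    ∫⁻ x, ENNReal.ofReal (|∑ k, (x (e (k, false)) - x (e (k, true)))| ^ (2 * p))
        ∂(Measure.pi fun _ : τ => ν) ≤
      ENNReal.ofReal (pairConst p * (Fintype.card ι : ℝ) ^ p) *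
        ∫⁻ x, ENNReal.ofReal (|x| ^ (2 * p)) ∂ν := by
  classical
  set A : ℝ := 2 * (2 * p) ^ (2 * p) * Real.exp (1 / 2)
  set N : ℝ := ((Fintype.card ι : ℕ) : ℝ) with hN
  have hNpos : 0 < N := by rw [hN]; exact_mod_cast Fintype.card_pos
  have hA0 : 0 ≤ A := by positivity
  set B : ℝ := A * (N ^ (p - 1) * 2 ^ (2 * p)) with hB
  have hB0 : 0 ≤ B := by positivity
  set M := ∫⁻ x, ENNReal.ofReal (|x| ^ (2 * p)) ∂ν
  set π := Measure.pi fun _ : τ => ν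
  let F : (τ → ℝ) → ℝ≥0∞ := fun x =>
    ENNReal.ofReal (|∑ k, (x (e (k, false)) - x (e (k, true)))| ^ (2 * p))
  have hFm : Measurable F := by fun_prop
  let G (ε : ι → Bool) (x : τ → ℝ) : ℝ :=
    ∑ k, bif ε k then -(x (e (k, false)) - x (e (k, true)))
      else x (e (k, false)) - x (e (k, true))
  have hflip (ε : ι → Bool) : ∫⁻ x, F x ∂π = ∫⁻ x, ENNReal.ofReal (|G ε x| ^ (2 * p)) ∂π := by
    let s : Equiv.Perm (ι × Bool) := Equiv.prodShear (Equiv.refl ι)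
      fun k => bif ε k then Equiv.boolNot else Equiv.refl Bool
    rw [← (measurePreserving_pi_comp_perm ν (e.symm.trans (s.trans e))).lintegral_comp hFm]
    refine lintegral_congr fun x => ?_
    have : ∀ k, x (e (s (k, false))) - x (e (s (k, true))) =
        bif ε k then -(x (e (k, false)) - x (e (k, true)))
          else x (e (k, false)) - x (e (k, true)) := by
      intro k
      cases h : ε k <;> simp [s, h]
    simp only [F, G, Equiv.trans_apply, Equiv.symm_apply_apply, this]
  have hpoint (x : τ → ℝ) : ∑ ε : ι → Bool, |G ε x| ^ (2 * p) ≤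
      2 ^ Fintype.card ι * B * ∑ i, |x i| ^ (2 * p) := by
    refine (sum_signs_rpow_le_sum_rpow hp _).trans ?_
    have : ∑ k, |x (e (k, false)) - x (e (k, true))| ^ (2 * p) ≤
        2 ^ (2 * p) * ∑ i, |x i| ^ (2 * p) := by
      rw [← e.sum_comp, Fintype.sum_prod_type, Finset.mul_sum]
      refine Finset.sum_le_sum fun k _ => ?_
      rw [Fintype.sum_bool, add_comm]
      exact abs_sub_rpow_le (by linarith) _ _
    calc _ ≤ 2 ^ Fintype.card ι * A * (N ^ (p - 1) * (2 ^ (2 * p) * ∑ i, |x i| ^ (2 * p))) := by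
          gcongr
      _ = _ := by rw [hB]; ring
  have hmarg (i : τ) : ∫⁻ x, ENNReal.ofReal (|x i| ^ (2 * p)) ∂π = M :=
    (measurePreserving_eval (fun _ : τ => ν) i).lintegral_comp
      (f := fun t => ENNReal.ofReal (|t| ^ (2 * p))) (by fun_prop)
  have hcard : (Fintype.card τ : ℝ) = N * 2 := by
    rw [← Fintype.card_congr e, Fintype.card_prod, Fintype.card_bool]; push_cast; rfl
  have hsum : ENNReal.ofReal (2 ^ Fintype.card ι) * ∫⁻ x, F x ∂π ≤
      ENNReal.ofReal (2 ^ Fintype.card ι) * (ENNReal.ofReal (pairConst p * N ^ p) * M) :=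
    calc ENNReal.ofReal (2 ^ Fintype.card ι) * ∫⁻ x, F x ∂π
        = ∑ _ε : ι → Bool, ∫⁻ x, F x ∂π := by
          rw [Finset.sum_const, Finset.card_univ, Fintype.card_fun, Fintype.card_bool,
            nsmul_eq_mul, ENNReal.ofReal_pow (by norm_num)]
          norm_num
      _ = ∫⁻ x, ∑ ε : ι → Bool, ENNReal.ofReal (|G ε x| ^ (2 * p)) ∂π := by
          rw [lintegral_finsetSum]
          · exact Finset.sum_congr rfl fun ε _ => hflip ε
          · intro ε _
            have : Measurable (G ε) := by
              refine Finset.measurable_fun_sum _ fun k _ => ?_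
              cases ε k <;> simp only [cond_true, cond_false] <;> fun_prop
            fun_prop
      _ ≤ ∫⁻ x, ENNReal.ofReal (2 ^ Fintype.card ι * B) *
            ∑ i, ENNReal.ofReal (|x i| ^ (2 * p)) ∂π := by
          refine lintegral_mono fun x => ?_
          rw [← ENNReal.ofReal_sum_of_nonneg fun _ _ => by positivity,
            ← ENNReal.ofReal_sum_of_nonneg fun _ _ => by positivity,
            ← ENNReal.ofReal_mul (by positivity)]
          exact ENNReal.ofReal_le_ofReal (hpoint x)
      _ = ENNReal.ofReal (2 ^ Fintype.card ι * B) * (ENNReal.ofReal (N * 2) * M) := by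
          rw [lintegral_const_mul _ (by fun_prop), lintegral_finsetSum _ fun _ _ => by fun_prop,
            Finset.sum_congr rfl fun i _ => hmarg i, Finset.sum_const, Finset.card_univ,
            nsmul_eq_mul, ← hcard, ENNReal.ofReal_natCast]
      _ = _ := by
          rw [← mul_assoc, ← ENNReal.ofReal_mul (by positivity),
            ← mul_assoc (ENNReal.ofReal (2 ^ Fintype.card ι)) _ M,
            ← ENNReal.ofReal_mul (by positivity)]
          congr 2
          have : N ^ p = N ^ (p - 1) * N := by
            rw [← Real.rpow_add_one hNpos.ne', sub_add_cancel]
          rw [this, hB, pairConst]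
          ring
  exact (ENNReal.mul_le_mul_iff_right (by simp) ENNReal.ofReal_ne_top).1 hsum

/-- The indices below `2 ^ (m + 1)`, grouped in consecutive pairs `2 * k`, `2 * k + 1`. -/
def pairIndex (m : ℕ) : Fin (2 ^ m) × Bool ≃ Fin (2 ^ (m + 1)) :=
  ((Equiv.refl _).prodCongr finTwoEquiv.symm).trans
    (finProdFinEquiv.trans (finCongr (pow_succ 2 m).symm))

lemma pairIndex_false (m : ℕ) (k : Fin (2 ^ m)) : (pairIndex m (k, false) : ℕ) = 2 * k := by
  simp [pairIndex, finTwoEquiv]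

lemma pairIndex_true (m : ℕ) (k : Fin (2 ^ m)) : (pairIndex m (k, true) : ℕ) = 2 * k + 1 := by
  simp [pairIndex, finTwoEquiv, add_comm]

lemma abs_deltaN_rpow_le {h : ℝ → ℝ} {p K : ℝ} (hp : 0 ≤ p) (h1 : Differentiable ℝ h)
    (h2 : Differentiable ℝ (deriv h)) (hK : ∀ z, |deriv (deriv h) z| ≤ K) (m : ℕ)
    (x : Fin (2 ^ (m + 1)) → ℝ) :
    |deltaN h (m + 1) (fun i => if h : i < 2 ^ (m + 1) then x ⟨i, h⟩ else 0)| ^ p ≤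
      (K / 8) ^ p * ((2 : ℝ) ^ m) ^ (-(2 * p)) *
        |∑ k, (x (pairIndex m (k, false)) - x (pairIndex m (k, true)))| ^ (2 * p) := by
  have hK0 : 0 ≤ K := (abs_nonneg _).trans (hK 0)
  set S := ∑ k, (x (pairIndex m (k, false)) - x (pairIndex m (k, true)))
  have hle := abs_deltaN_succ_le h1 h2 hK m
    (fun i => if h : i < 2 ^ (m + 1) then x ⟨i, h⟩ else 0)
  have hSum : ∑ k ∈ Finset.range (2 ^ m),
      ((if h : 2 * k < 2 ^ (m + 1) then x ⟨2 * k, h⟩ else 0) -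
        (if h : 2 * k + 1 < 2 ^ (m + 1) then x ⟨2 * k + 1, h⟩ else 0)) = S := by
    rw [Finset.sum_range]
    refine Finset.sum_congr rfl fun k _ => ?_
    have hk := k.2
    rw [dif_pos (by rw [pow_succ]; omega), dif_pos (by rw [pow_succ]; omega)]
    congr 2 <;> ext
    · exact (pairIndex_false m k).symm
    · exact (pairIndex_true m k).symm
  rw [hSum] at hle
  calc _ ≤ (K / 8 * (S / 2 ^ m) ^ 2) ^ p := by gcongr
    _ = (K / 8) ^ p * (|S| / 2 ^ m) ^ (2 * p) := by
      rw [Real.mul_rpow (by positivity) (by positivity), Real.rpow_mul (by positivity),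
        Real.rpow_two, div_pow, div_pow, sq_abs]
    _ = _ := by
      rw [Real.div_rpow (abs_nonneg S) (by positivity), Real.rpow_neg (by positivity)]
      ring

lemma lintegral_comp_eq_of_map_eq_compProd {Ω α β : Type*} [MeasurableSpace Ω]
    [MeasurableSpace α] [MeasurableSpace β] {μ : Measure Ω} [IsProbabilityMeasure μ]
    {Y : Ω → α} {Z : Ω → β} {κ : Kernel α β} [IsMarkovKernel κ] (hY : Measurable Y)
    (hZ : Measurable Z) (h : μ.map (fun ω => (Y ω, Z ω)) = (μ.map Y) ⊗ₘ κ)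
    {f : β → ℝ≥0∞} (hf : Measurable f) :
    ∫⁻ ω, f (Z ω) ∂μ = ∫⁻ y, ∫⁻ z, f z ∂(κ y) ∂(μ.map Y) := by
  have : IsProbabilityMeasure (μ.map Y) := Measure.isProbabilityMeasure_map hY.aemeasurable
  rw [← Measure.lintegral_compProd (f := fun z : α × β => f z.2) (by fun_prop), ← h,
    lintegral_map (by fun_prop) (by fun_prop)]

lemma lintegral_abs_deltaN_succ_rpow_le {Ω α : Type*} [MeasurableSpace Ω] [MeasurableSpace α]
    {p K : ℝ} (hp : 1 ≤ p) (hK0 : 0 ≤ K) {g : α → ℝ → ℝ} (hg : LBS g K) {μ : Measure Ω}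
    [IsProbabilityMeasure μ] {Y : Ω → α} {X : Ω → ℝ} {m : ℕ} {Z : Ω → Fin (2 ^ (m + 1)) → ℝ}
    {κ : Kernel α ℝ} [IsMarkovKernel κ] {η : Kernel α (Fin (2 ^ (m + 1)) → ℝ)}
    (hY : Measurable Y) (hX : Measurable X) (hZ : Measurable Z)
    (hκ : μ.map (fun ω => (Y ω, X ω)) = (μ.map Y) ⊗ₘ κ)
    (hη : ∀ y, η y = Measure.pi fun _ => κ y)
    (hηZ : μ.map (fun ω => (Y ω, Z ω)) = (μ.map Y) ⊗ₘ η) :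
    ∫⁻ ω, ENNReal.ofReal (|deltaN (g (Y ω)) (m + 1)
        (fun i => if h : i < 2 ^ (m + 1) then Z ω ⟨i, h⟩ else 0)| ^ p) ∂μ ≤
      ENNReal.ofReal ((K / 8) ^ p * pairConst p * ((2 : ℝ) ^ m) ^ (-p)) *
        ∫⁻ ω, ENNReal.ofReal (|X ω| ^ (2 * p)) ∂μ := by
  have : IsMarkovKernel η := ⟨fun y => by rw [hη]; infer_instance⟩
  set D : ℝ := (K / 8) ^ p * ((2 : ℝ) ^ m) ^ (-(2 * p)) with hD
  have hD0 : 0 ≤ D := by positivity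
  let T (x : Fin (2 ^ (m + 1)) → ℝ) : ℝ≥0∞ := ENNReal.ofReal
    (|∑ k, (x (pairIndex m (k, false)) - x (pairIndex m (k, true)))| ^ (2 * p))
  have hT : Measurable T := by fun_prop
  calc _ ≤ ∫⁻ ω, ENNReal.ofReal D * T (Z ω) ∂μ := by
        refine lintegral_mono fun ω => ?_
        rw [← ENNReal.ofReal_mul hD0]
        obtain ⟨h1, h2, h3⟩ := hg (Y ω)
        exact ENNReal.ofReal_le_ofReal (abs_deltaN_rpow_le (by linarith) h1 h2 h3 m _)
    _ = ENNReal.ofReal D * ∫⁻ y, ∫⁻ x, T x ∂(η y) ∂(μ.map Y) := by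
        rw [lintegral_const_mul' _ _ ENNReal.ofReal_ne_top,
          lintegral_comp_eq_of_map_eq_compProd hY hZ hηZ hT]
    _ ≤ ENNReal.ofReal D * ∫⁻ y, ENNReal.ofReal (pairConst p * ((2 : ℝ) ^ m) ^ p) *
          ∫⁻ t, ENNReal.ofReal (|t| ^ (2 * p)) ∂(κ y) ∂(μ.map Y) := by
        gcongr with y
        rw [hη]
        simpa only [Fintype.card_fin, Nat.cast_pow, Nat.cast_ofNat] using
          lintegral_abs_sum_sub_rpow_le (pairIndex m) hp (κ y)
    _ = _ := by
        rw [lintegral_const_mul' _ _ ENNReal.ofReal_ne_top,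
          ← lintegral_comp_eq_of_map_eq_compProd hY hX hκ
            (f := fun t => ENNReal.ofReal (|t| ^ (2 * p))) (by fun_prop), ← mul_assoc,
          ← ENNReal.ofReal_mul hD0]
        congr 2
        have hpow : ((2 : ℝ) ^ m) ^ (-(2 * p)) * ((2 : ℝ) ^ m) ^ p = ((2 : ℝ) ^ m) ^ (-p) := by
          rw [← Real.rpow_add (by positivity)]
          congr 1
          ring
        rw [hD, ← hpow]
        ring

/-- for `p ≥ 2` and `g` satisfying LBS with constant `K`, there is a constant `C`
depending only on `p` and `K` such that whenever `(Y, X)` has `E[|X|^{2p}] < ∞` and, for each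
`n ≥ 1`, `X(1), …, X(2ⁿ)` are conditionally i.i.d. given `Y` with the conditional distribution
of `X` given `Y`, the quantity `Δ_n := Δ_n(g(Y,·); X(1), …, X(2ⁿ))` satisfies
`E[|Δ_n|^p] ≤ C · E[|X|^{2p}] · 2^{−pn}`. -/
theorem stmt_8 (p K : ℝ) (hp : 2 ≤ p) :
    ∃ C : ℝ, ∀ (Ω : Type*) (J : ℕ) [MeasurableSpace Ω]
      (g : (Fin J → ℝ) → ℝ → ℝ), LBS g K →
      ∀ (μ : Measure Ω) [IsProbabilityMeasure μ]
        (Y : Ω → Fin J → ℝ) (X : Ω → ℝ)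
        (Xs : (n : ℕ) → Fin (2 ^ n) → Ω → ℝ)
        (κ : Kernel (Fin J → ℝ) ℝ) [IsMarkovKernel κ]
        (κpi : (n : ℕ) → Kernel (Fin J → ℝ) (Fin (2 ^ n) → ℝ)),
        Measurable Y → Measurable X → (∀ n i, Measurable (Xs n i)) →
        -- `κ` is a version of the conditional distribution of `X` given `Y`:
        μ.map (fun ω => (Y ω, X ω)) = (μ.map Y) ⊗ₘ κ →
        -- conditionally on `Y`, the `X(i)` are i.i.d. with law `κ Y`:
        (∀ n y, κpi n y = Measure.pi fun _ : Fin (2 ^ n) => κ y) →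
        (∀ n : ℕ, μ.map (fun ω => (Y ω, fun i : Fin (2 ^ n) => Xs n i ω)) =
          (μ.map Y) ⊗ₘ κpi n) →
        ∫⁻ ω, ENNReal.ofReal (|X ω| ^ (2 * p)) ∂μ < ⊤ →
        ∀ n : ℕ, 1 ≤ n →
          ∫⁻ ω, ENNReal.ofReal
              (|deltaN (g (Y ω)) n
                  (fun i => if h : i < 2 ^ n then Xs n ⟨i, h⟩ ω else 0)| ^ p) ∂μ ≤
            ENNReal.ofReal C * (∫⁻ ω, ENNReal.ofReal (|X ω| ^ (2 * p)) ∂μ) *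
              ENNReal.ofReal ((2 : ℝ) ^ (-(p * n))) := by
  refine ⟨(K / 8) ^ p * pairConst p * 2 ^ p, ?_⟩
  intro Ω J _ g hg μ _ Y X Xs κ _ κpi hY hX hXs hκ hκpi hjoint _ n hn
  obtain ⟨m, rfl⟩ := Nat.exists_eq_add_of_le' hn
  have hK0 : 0 ≤ K := (abs_nonneg _).trans ((hg 0).2.2 0)
  have hC0 : 0 ≤ (K / 8) ^ p * pairConst p * 2 ^ p := by unfold pairConst; positivity
  refine (lintegral_abs_deltaN_succ_rpow_le (by linarith) hK0 hg hY hX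
    (measurable_pi_iff.2 (hXs (m + 1))) hκ (hκpi (m + 1)) (hjoint (m + 1))).trans_eq ?_
  rw [mul_right_comm (ENNReal.ofReal _), ← ENNReal.ofReal_mul hC0]
  congr 2
  have hpow : ((2 : ℝ) ^ m) ^ (-p) = 2 ^ p * 2 ^ (-(p * (m + 1 : ℕ))) := by
    rw [← Real.rpow_natCast, ← Real.rpow_mul (by norm_num), ← Real.rpow_add (by norm_num)]
    congr 1
    push_cast
    ring
  rw [hpow]
  ring
end

section
/- Let 0 < r < 1 and let (Δ_n)_{n≥0} be a sequence of integrable real random variables on a probability space. Let N ~ Geo(r) be independent of the whole sequence (Δ_n)_{n≥0}, and set R := Δ_N / p_r(N). Then E[|R|] = Σ_{n=0}^∞ E[|Δ_n|] (as an equality in [0, ∞]). In particular, if Σ_{n=0}^∞ E[|Δ_n|] < ∞, then R is integrable and E[R] = Σ_{n=0}^∞ E[Δ_n]. -/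
open MeasureTheory ProbabilityTheory
open scoped ENNReal

/-- The pmf of the geometric distribution `Geo(r)` on `{0,1,2,…}`: `p_r(n) = r (1−r)ⁿ`. -/
noncomputable def pGeo (r : ℝ) (n : ℕ) : ℝ := r * (1 - r) ^ n

lemma pGeo_pos {r : ℝ} (hr0 : 0 < r) (hr1 : r < 1) (n : ℕ) : 0 < pGeo r n :=
  mul_pos hr0 (pow_pos (sub_pos.2 hr1) n)

lemma ProbabilityTheory.IndepFun.setLIntegral_preimage {Ω α β : Type*} [MeasurableSpace Ω]
    [MeasurableSpace α] [MeasurableSpace β] {μ : Measure Ω} {X : Ω → α} {Y : Ω → β}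
    (hXY : IndepFun X Y μ) (hX : Measurable X) (hY : Measurable Y) {s : Set α}
    (hs : MeasurableSet s) {f : β → ℝ≥0∞} (hf : Measurable f) :
    ∫⁻ ω in X ⁻¹' s, f (Y ω) ∂μ = μ (X ⁻¹' s) * ∫⁻ ω, f (Y ω) ∂μ := by
  have hind : Measurable (s.indicator (1 : α → ℝ≥0∞)) := measurable_one.indicator hs
  have hmul := lintegral_mul_eq_lintegral_mul_lintegral_of_indepFun (hind.comp hX) (hf.comp hY)
    (hXY.comp hind hf)
  have hcomp : s.indicator (1 : α → ℝ≥0∞) ∘ X = (X ⁻¹' s).indicator 1 := rfl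
  rw [hcomp, lintegral_indicator_one (hX hs)] at hmul
  rw [← lintegral_indicator (hX hs)]
  refine Eq.trans (lintegral_congr fun ω => ?_) hmul
  by_cases h : ω ∈ X ⁻¹' s <;> simp [h]

/-- let `0 < r < 1`, `(Δ_n)_{n ≥ 0}` integrable, `N ~ Geo(r)` independent of the
whole sequence, and `R := Δ_N / p_r(N)`. Then `E[|R|] = ∑ₙ E[|Δ_n|]` (in `[0,∞]`); in
particular if `∑ₙ E[|Δ_n|] < ∞` then `R` is integrable and `E[R] = ∑ₙ E[Δ_n]`. -/
theorem stmt_10 (r : ℝ) (hr0 : 0 < r) (hr1 : r < 1)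
    {Ω : Type*} [MeasurableSpace Ω] (μ : Measure Ω) [IsProbabilityMeasure μ]
    (Δ : ℕ → Ω → ℝ) (hΔmeas : ∀ n, Measurable (Δ n)) (hΔint : ∀ n, Integrable (Δ n) μ)
    (N : Ω → ℕ) (hNmeas : Measurable N)
    (hNlaw : ∀ n : ℕ, μ (N ⁻¹' {n}) = ENNReal.ofReal (pGeo r n))
    (hindep : IndepFun N (fun ω => fun n : ℕ => Δ n ω) μ)
    (R : Ω → ℝ) (hR : ∀ ω, R ω = Δ (N ω) ω / pGeo r (N ω)) :
    (∫⁻ ω, ENNReal.ofReal |R ω| ∂μ = ∑' n : ℕ, ∫⁻ ω, ENNReal.ofReal |Δ n ω| ∂μ) ∧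
    ((∑' n : ℕ, ∫⁻ ω, ENNReal.ofReal |Δ n ω| ∂μ) < ⊤ →
      Integrable R μ ∧ ∫ ω, R ω ∂μ = ∑' n : ℕ, ∫ ω, Δ n ω ∂μ) := by
  have hms (n : ℕ) : MeasurableSet (N ⁻¹' {n}) := hNmeas (measurableSet_singleton n)
  have hdisj : Pairwise (Function.onFun Disjoint fun n : ℕ => N ⁻¹' {n}) :=
    pairwise_disjoint_fiber N
  have hunion : ⋃ n : ℕ, N ⁻¹' {n} = Set.univ := by
    rw [← Set.preimage_iUnion, Set.iUnion_of_singleton, Set.preimage_univ]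
  have hΔseq : Measurable fun ω => fun n : ℕ => Δ n ω := measurable_pi_lambda _ hΔmeas
  have hRmeas : Measurable R := by
    have hprod : Measurable fun q : Ω × ℕ => Δ q.2 q.1 / pGeo r q.2 :=
      measurable_from_prod_countable_left fun n => (hΔmeas n).div_const (pGeo r n)
    rw [funext hR]
    exact hprod.comp (measurable_id.prodMk hNmeas)
  have hRset (n : ℕ) : Set.EqOn R (fun ω => Δ n ω / pGeo r n) (N ⁻¹' {n}) := by
    intro ω hω
    have hN : N ω = n := hω
    simp only [hR, hN]
  have habs : ∫⁻ ω, ENNReal.ofReal |R ω| ∂μ = ∑' n : ℕ, ∫⁻ ω, ENNReal.ofReal |Δ n ω| ∂μ := by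
    rw [← setLIntegral_univ, ← hunion, lintegral_iUnion hms hdisj]
    refine tsum_congr fun n => ?_
    have hp := pGeo_pos hr0 hr1 n
    have hf : Measurable fun x : ℕ → ℝ => ENNReal.ofReal |x n / pGeo r n| := by fun_prop
    rw [setLIntegral_congr_fun (hms n) fun ω hω => by rw [hRset n hω],
      hindep.setLIntegral_preimage hNmeas hΔseq (measurableSet_singleton n) hf, hNlaw,
      ← lintegral_const_mul' _ _ ENNReal.ofReal_ne_top]
    refine lintegral_congr fun ω => ?_
    rw [← ENNReal.ofReal_mul hp.le, abs_div, abs_of_pos hp, mul_div_cancel₀ _ hp.ne']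
  refine ⟨habs, fun hfin => ?_⟩
  have hRint : Integrable R μ := by
    refine ⟨hRmeas.aestronglyMeasurable, ?_⟩
    rw [hasFiniteIntegral_iff_norm]
    simpa only [Real.norm_eq_abs, habs] using hfin
  refine ⟨hRint, ?_⟩
  rw [← setIntegral_univ, ← hunion, integral_iUnion hms hdisj hRint.integrableOn]
  refine tsum_congr fun n => ?_
  have hp := pGeo_pos hr0 hr1 n
  have hmeas : Measurable fun x : ℕ → ℝ => x n / pGeo r n := by fun_prop
  rw [setIntegral_congr_fun (hms n) (hRset n),
    Indep.setIntegral_eq_mul hNmeas.comap_le hindep hΔseq.aemeasurable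
      ⟨{n}, measurableSet_singleton n, rfl⟩ hmeas.aestronglyMeasurable,
    measureReal_def, hNlaw, ENNReal.toReal_ofReal hp.le, integral_div, mul_div_cancel₀ _ hp.ne']
end
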